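/- arXiv:0706.0545 — 4 statements merged into one kernel-verified Lean document; each statement's English description precedes it below -/
import Mathlib

section
/- Let T = (V,E) be a weighted tree that admits an ε-reasonable coloring χ for some ε > 0. Then T embeds into ℝ^k (with the Euclidean norm) with distortion at most C/ε for a universal constant C, where k is the number of colors used by χ. -/
open scoped ENNReal

namespace TreePaper

/-- A metric tree: a connected graph-theoretic tree together with positive edge weights.
The associated metric is the induced weighted shortest-path metric on the vertices. -/
structure MetricTree where
  V : Type
  G : SimpleGraph V
  isTree : G.IsTree
  w : Sym2 V → ℝ
  w_pos : ∀ e ∈ G.edgeSet, 0 < w e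

/-- The unique path between two vertices of a metric tree. -/
noncomputable def MetricTree.path (T : MetricTree) (u v : T.V) : T.G.Walk u v :=
  (T.isTree.existsUnique_path u v).exists.choose

/-- The weighted shortest-path metric of a metric tree. -/
noncomputable def MetricTree.dist (T : MetricTree) (u v : T.V) : ℝ :=
  ((T.path u v).edges.map T.w).sum

/-- `ℓ^χ_k(u,v)`: total weight of the edges of color `k` on the path from `u` to `v`. -/
noncomputable def colorLen (T : MetricTree) (χ : Sym2 T.V → ℤ) (k : ℤ) (u v : T.V) : ℝ :=
  (((T.path u v).edges.filter (fun e => χ e = k)).map T.w).sum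

/-- `w` is the least common ancestor of `u` and `v` in the tree `T` rooted at `r`. -/
def IsLCA (T : MetricTree) (r u v w : T.V) : Prop :=
  w ∈ (T.path r u).support ∧ w ∈ (T.path r v).support ∧
    ∀ z, z ∈ (T.path r u).support → z ∈ (T.path r v).support → z ∈ (T.path r w).support

/-- An `ε`-reasonable coloring (not necessarily monotone): for all `u,v` with least common
ancestor `w` there is a color whose total lengths on the paths `P(w,u)` and `P(w,v)` differ
by at least `ε · d_T(u,v)`. -/
def IsReasonable (T : MetricTree) (r : T.V) (ε : ℝ) (χ : Sym2 T.V → ℤ) : Prop :=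
  ∀ u v w : T.V, IsLCA T r u v w →
    ∃ c : ℤ, ε * T.dist u v ≤ |colorLen T χ c w u - colorLen T χ c w v|

/-- A bi-Lipschitz map of `(X, dX)` into a (pseudo)metric space, with distortion ≤ `D`. -/
def BiLipWith {X E : Type*} [PseudoMetricSpace E] (dX : X → X → ℝ) (f : X → E) (D : ℝ) : Prop :=
  ∃ s : ℝ, 0 < s ∧ ∀ x y : X,
    s * dX x y ≤ dist (f x) (f y) ∧ dist (f x) (f y) ≤ s * D * dX x y

section

variable (T : MetricTree)

lemma MetricTree.path_isPath (u v : T.V) : (T.path u v).IsPath :=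
  (T.isTree.existsUnique_path u v).exists.choose_spec

variable {T}

lemma MetricTree.path_eq {u v : T.V} {p : T.G.Walk u v} (hp : p.IsPath) : T.path u v = p :=
  (T.isTree.existsUnique_path u v).unique (T.path_isPath u v) hp

lemma MetricTree.path_append {u v w : T.V} (h : w ∈ (T.path u v).support) :
    (T.path u w).append (T.path w v) = T.path u v := by
  classical
  rw [path_eq ((T.path_isPath u v).takeUntil h), path_eq ((T.path_isPath u v).dropUntil h)]
  exact SimpleGraph.Walk.take_spec _ h

lemma MetricTree.mem_path_or_mem_path {u v w z : T.V} (hw : w ∈ (T.path u v).support)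
    (hz : z ∈ (T.path u v).support) :
    z ∈ (T.path u w).support ∨ w ∈ (T.path u z).support := by
  rw [← path_append hw, SimpleGraph.Walk.mem_support_append_iff] at hz
  refine hz.imp_right fun hz => ?_
  have happ : ((T.path u w).append (T.path w z)).append (T.path z v) = T.path u v := by
    rw [← SimpleGraph.Walk.append_assoc, path_append hz, path_append hw]
  have hpath : ((T.path u w).append (T.path w z)).IsPath :=
    SimpleGraph.Walk.IsPath.of_append_left (happ ▸ T.path_isPath u v)
  rw [path_eq hpath, SimpleGraph.Walk.mem_support_append_iff]
  exact Or.inl (SimpleGraph.Walk.end_mem_support _)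

lemma exists_isLCA (r u v : T.V) : ∃ w, IsLCA T r u v w := by
  have hfin : {w | w ∈ (T.path r u).support ∧ w ∈ (T.path r v).support}.Finite :=
    (List.finite_toSet (T.path r u).support).subset fun w hw => hw.1
  obtain ⟨w, ⟨hwu, hwv⟩, hmax⟩ := Set.exists_max_image _ (fun w => (T.path r w).length) hfin
    ⟨r, SimpleGraph.Walk.start_mem_support _, SimpleGraph.Walk.start_mem_support _⟩
  refine ⟨w, hwu, hwv, fun z hzu hzv => ?_⟩
  refine (MetricTree.mem_path_or_mem_path hwu hzu).elim id fun hwz => ?_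
  have hlen : (T.path r z).length ≤ (T.path r w).length := hmax z ⟨hzu, hzv⟩
  rw [← MetricTree.path_append hwz, SimpleGraph.Walk.length_append] at hlen
  have hwz : w = z := SimpleGraph.Walk.eq_of_length_eq_zero (p := T.path w z) (by omega)
  exact hwz ▸ SimpleGraph.Walk.end_mem_support _

lemma colorLen_add (χ : Sym2 T.V → ℤ) (c : ℤ) {u v w : T.V} (h : w ∈ (T.path u v).support) :
    colorLen T χ c u v = colorLen T χ c u w + colorLen T χ c w v := by
  simp only [colorLen]
  rw [← MetricTree.path_append h, SimpleGraph.Walk.edges_append, List.filter_append,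
    List.map_append, List.sum_append]

lemma colorLen_comm (χ : Sym2 T.V → ℤ) (c : ℤ) (u v : T.V) :
    colorLen T χ c u v = colorLen T χ c v u := by
  simp only [colorLen]
  rw [MetricTree.path_eq (T.path_isPath v u).reverse, SimpleGraph.Walk.edges_reverse,
    List.filter_reverse, List.map_reverse, List.sum_reverse]

lemma colorLen_triangle (χ : Sym2 T.V → ℤ) (c : ℤ) (u v w : T.V) :
    colorLen T χ c u v ≤ colorLen T χ c u w + colorLen T χ c w v := by
  classical
  simp only [colorLen]
  rw [← List.sum_append, ← List.map_append, ← List.filter_append,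
    ← SimpleGraph.Walk.edges_append]
  set q := (T.path u w).append (T.path w v)
  have hsub : ((T.path u v).edges.filter (fun e => χ e = c)).Subperm
      (q.edges.filter (fun e => χ e = c)) := by
    refine List.Subperm.filter _ (List.subperm_of_subset (T.path_isPath u v).isTrail.edges_nodup ?_)
    rw [MetricTree.path_eq q.bypass_isPath]
    exact q.edges_bypass_subset_edges
  obtain ⟨l, hperm, hl⟩ := hsub
  rw [← (hperm.map T.w).sum_eq]
  refine (hl.map T.w).sum_le_sum fun x hx => ?_
  obtain ⟨e, he, rfl⟩ := List.mem_map.1 hx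
  exact (T.w_pos e (q.edges_subset_edgeSet (List.mem_of_mem_filter he))).le

lemma abs_colorLen_sub_le (χ : Sym2 T.V → ℤ) (c : ℤ) (r u v : T.V) :
    |colorLen T χ c r u - colorLen T χ c r v| ≤ colorLen T χ c u v := by
  have huv := colorLen_triangle χ c r u v
  have hvu := colorLen_triangle χ c r v u
  rw [colorLen_comm χ c v u] at huv
  rw [abs_le]
  constructor <;> linarith

lemma colorLen_eq_zero {χ : Sym2 T.V → ℤ} {c : ℤ} (hc : ¬ ∃ e ∈ T.G.edgeSet, χ e = c)
    (u v : T.V) : colorLen T χ c u v = 0 := by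
  have hnil : (T.path u v).edges.filter (fun e => χ e = c) = [] :=
    List.filter_eq_nil_iff.2 fun e he hec =>
      hc ⟨e, (T.path u v).edges_subset_edgeSet he, of_decide_eq_true hec⟩
  rw [colorLen, hnil, List.map_nil, List.sum_nil]

lemma sum_sum_filter_eq {α ι : Type*} [DecidableEq ι] (f : α → ℝ) (g : α → ι) (s : Finset ι)
    (l : List α) (hl : ∀ a ∈ l, g a ∈ s) :
    ∑ i ∈ s, ((l.filter (fun a => g a = i)).map f).sum = (l.map f).sum := by
  induction l with
  | nil => simp
  | cons a l ih =>
    have hsplit (i : ι) : (((a :: l).filter (fun a => g a = i)).map f).sum =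
        (if g a = i then f a else 0) + ((l.filter (fun a => g a = i)).map f).sum := by
      by_cases h : g a = i <;> simp [h]
    simp_rw [hsplit]
    rw [Finset.sum_add_distrib, ih fun b hb => hl b (List.mem_cons_of_mem a hb)]
    simp [hl a List.mem_cons_self]

lemma sum_colorLen {χ : Sym2 T.V → ℤ} {s : Finset ℤ} (hs : ∀ e ∈ T.G.edgeSet, χ e ∈ s)
    (u v : T.V) : ∑ c ∈ s, colorLen T χ c u v = T.dist u v :=
  sum_sum_filter_eq T.w χ s _ fun e he => hs e ((T.path u v).edges_subset_edgeSet he)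

end

/-- There is a universal constant `C > 0` such that every weighted tree
admitting an `ε`-reasonable coloring with `k` colors embeds into `ℝ^k` with distortion at
most `C/ε`. -/
theorem reasonable_coloring_embedding :
    ∃ C : ℝ, 0 < C ∧ ∀ (T : MetricTree) (r : T.V) (ε : ℝ) (χ : Sym2 T.V → ℤ) (k : ℕ),
      0 < ε → IsReasonable T r ε χ →
      {c : ℤ | ∃ e ∈ T.G.edgeSet, χ e = c}.Finite →
      {c : ℤ | ∃ e ∈ T.G.edgeSet, χ e = c}.ncard = k →
      ∃ f : T.V → EuclideanSpace ℝ (Fin k), BiLipWith T.dist f (C / ε) := by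
  refine ⟨1, one_pos, fun T r ε χ k hε hχ hfin hk => ?_⟩
  let σ := @Finite.equivFinOfCardEq _ hfin.to_subtype _ hk
  refine ⟨fun v => WithLp.toLp 2 fun i => colorLen T χ (σ.symm i) r v, ε, hε, fun u v => ⟨?_, ?_⟩⟩
  · obtain ⟨w, hw⟩ := exists_isLCA r u v
    obtain ⟨c, hc⟩ := hχ u v w hw
    refine hc.trans ?_
    by_cases hcS : ∃ e ∈ T.G.edgeSet, χ e = c
    · rw [dist_eq_norm]
      refine le_trans (le_of_eq ?_) (PiLp.norm_apply_le _ (σ ⟨c, hcS⟩))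
      simp [colorLen_add χ c hw.1, colorLen_add χ c hw.2.1]
    · simp [colorLen_eq_zero hcS]
  · rw [mul_one_div_cancel hε.ne', one_mul, EuclideanSpace.dist_eq,
      ← sum_colorLen (s := hfin.toFinset) (fun e he => hfin.mem_toFinset.2 ⟨e, he, rfl⟩)]
    have hsum : ∑ c ∈ hfin.toFinset, colorLen T χ c u v =
        ∑ i, colorLen T χ (σ.symm i) u v := by
      symm
      refine Finset.sum_bij (fun i _ => (σ.symm i : ℤ)) (fun i _ => ?_) (fun i _ j _ h => ?_)
        (fun c hc => ?_) (fun i _ => rfl)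
      · exact hfin.mem_toFinset.2 (σ.symm i).2
      · exact σ.symm.injective (Subtype.ext h)
      · exact ⟨σ ⟨c, hfin.mem_toFinset.1 hc⟩, Finset.mem_univ _, by simp⟩
    have hnonneg (c : ℤ) : 0 ≤ colorLen T χ c u v :=
      (abs_nonneg _).trans (abs_colorLen_sub_le χ c r u v)
    rw [hsum]
    refine (Real.sqrt_le_sqrt ?_).trans_eq (Real.sqrt_sq (Finset.sum_nonneg fun i _ => hnonneg _))
    refine le_trans (Finset.sum_le_sum fun i _ => ?_)
      (Finset.sum_sq_le_sq_sum_of_nonneg fun i _ => hnonneg _)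
    exact pow_le_pow_left₀ dist_nonneg (abs_colorLen_sub_le χ _ r u v) 2

end TreePaper
end

section
/- For every m ∈ ℕ and every x_0, x_1, …, x_{2^m} in a Hilbert space H, the following identity holds: ∑_{i=1}^{2^m} ‖x_i − x_{i−1}‖² = ‖x_{2^m} − x_0‖²/2^m + ∑_{k=1}^m (1/2^k) ∑_{j=1}^{2^{m−k}} ‖x_{j·2^k} − 2x_{(2j−1)·2^{k−1}} + x_{(j−1)·2^k}‖². -/
open scoped ENNReal

namespace TreePaper

theorem sum_Icc_one_succ_bot {M : Type*} [AddCommMonoid M] (f : ℕ → M) (m : ℕ) :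
    ∑ k ∈ Finset.Icc 1 (m + 1), f k = f 1 + ∑ k ∈ Finset.Icc 1 m, f (k + 1) := by
  induction m with
  | zero => simp
  | succ m ih =>
    rw [Finset.sum_Icc_succ_top (by omega), ih, Finset.sum_Icc_succ_top (by omega), add_assoc]

theorem sum_Icc_one_two_mul {M : Type*} [AddCommMonoid M] (f : ℕ → M) (n : ℕ) :
    ∑ i ∈ Finset.Icc 1 (2 * n), f i = ∑ j ∈ Finset.Icc 1 n, (f (2 * j - 1) + f (2 * j)) := by
  induction n with
  | zero => simp
  | succ n ih =>
    rw [show 2 * (n + 1) = 2 * n + 1 + 1 by ring, Finset.sum_Icc_succ_top (by omega),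
      Finset.sum_Icc_succ_top (by omega), ih, Finset.sum_Icc_succ_top (by omega), add_assoc]
    rfl

theorem norm_sub_sq_add_norm_sub_sq {H : Type*} [NormedAddCommGroup H]
    [InnerProductSpace ℝ H] (a b c : H) :
    ‖b - a‖ ^ 2 + ‖c - b‖ ^ 2 = (‖c - a‖ ^ 2 + ‖c - (2 : ℝ) • b + a‖ ^ 2) / 2 := by
  have h := parallelogram_law_with_norm ℝ (c - b) (b - a)
  rw [show c - b + (b - a) = c - a by abel,
    show c - b - (b - a) = c - (2 : ℝ) • b + a by rw [two_smul]; abel] at h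
  linarith

/-- The dyadic martingale identity in Hilbert space:
`∑_{i=1}^{2^m} ‖x_i - x_{i-1}‖² = ‖x_{2^m} - x_0‖²/2^m +
  ∑_{k=1}^m 2^{-k} ∑_{j=1}^{2^{m-k}} ‖x_{j2^k} - 2 x_{(2j-1)2^{k-1}} + x_{(j-1)2^k}‖²`. -/
theorem hilbert_dyadic_identity {H : Type*} [NormedAddCommGroup H]
    [InnerProductSpace ℝ H] [CompleteSpace H] (m : ℕ) (x : ℕ → H) :
    ∑ i ∈ Finset.Icc 1 (2 ^ m), ‖x i - x (i - 1)‖ ^ 2 =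
      ‖x (2 ^ m) - x 0‖ ^ 2 / 2 ^ m +
        ∑ k ∈ Finset.Icc 1 m, (1 / 2 ^ k : ℝ) *
          ∑ j ∈ Finset.Icc 1 (2 ^ (m - k)),
            ‖x (j * 2 ^ k) - (2 : ℝ) • x ((2 * j - 1) * 2 ^ (k - 1))
              + x ((j - 1) * 2 ^ k)‖ ^ 2 := by
  induction m generalizing x with
  | zero => simp
  | succ m ih =>
    have fine_to_coarse : ∑ i ∈ Finset.Icc 1 (2 ^ (m + 1)), ‖x i - x (i - 1)‖ ^ 2 =
        (1 / 2) * ∑ j ∈ Finset.Icc 1 (2 ^ m), ‖x (2 * j) - x (2 * (j - 1))‖ ^ 2 +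
        (1 / 2) * ∑ j ∈ Finset.Icc 1 (2 ^ m),
          ‖x (2 * j) - (2 : ℝ) • x (2 * j - 1) + x (2 * (j - 1))‖ ^ 2 := by
      rw [pow_succ', sum_Icc_one_two_mul, ← mul_add, ← Finset.sum_add_distrib, Finset.mul_sum]
      refine Finset.sum_congr rfl fun j _ => ?_
      rw [show 2 * j - 1 - 1 = 2 * (j - 1) by omega, norm_sub_sq_add_norm_sub_sq]
      ring
    rw [fine_to_coarse, ih fun i => x (2 * i), sum_Icc_one_succ_bot, mul_add, Finset.mul_sum]
    have coarse_terms : ∀ k ∈ Finset.Icc 1 m,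
        (1 / 2 : ℝ) * ((1 / 2 ^ k : ℝ) * ∑ j ∈ Finset.Icc 1 (2 ^ (m - k)),
          ‖x (2 * (j * 2 ^ k)) - (2 : ℝ) • x (2 * ((2 * j - 1) * 2 ^ (k - 1)))
            + x (2 * ((j - 1) * 2 ^ k))‖ ^ 2) =
        (1 / 2 ^ (k + 1) : ℝ) * ∑ j ∈ Finset.Icc 1 (2 ^ (m + 1 - (k + 1))),
          ‖x (j * 2 ^ (k + 1)) - (2 : ℝ) • x ((2 * j - 1) * 2 ^ (k + 1 - 1))
            + x ((j - 1) * 2 ^ (k + 1))‖ ^ 2 := by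
      intro k hk
      obtain ⟨l, rfl⟩ : ∃ l, k = l + 1 := ⟨k - 1, by have := Finset.mem_Icc.mp hk; omega⟩
      have double (a n : ℕ) : 2 * (a * 2 ^ n) = a * 2 ^ (n + 1) := by ring
      simp only [double, Nat.add_sub_add_right, Nat.add_sub_cancel]
      rw [← mul_assoc]
      congr 1
      rw [pow_succ _ (l + 1)]
      field_simp
    rw [Finset.sum_congr rfl coarse_terms]
    simp only [← pow_succ', mul_zero, Nat.add_sub_cancel, pow_one, Nat.sub_self, pow_zero, mul_one,
      mul_comm _ 2]
    rw [pow_succ (2 : ℝ) m]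
    ring

end TreePaper
end

section
/- For every m ∈ ℕ and every x_0, x_1, …, x_{2^m} in a Hilbert space H, with the convention x_j = x_0 for j ≤ 0, one has ∑_{i=1}^{2^m} ‖x_i − x_{i−1}‖² ≥ (1/2) · ‖x_{2^m} − x_0‖²/2^{2m} + (1/2) · ∑_{k=1}^m 2^{−2k} ∑_{t=1}^{2^m} ‖x_t − 2x_{t−2^{k−1}} + x_{t−2^k}‖². -/
open scoped ENNReal

namespace TreePaper

lemma sum_Icc_shift_le (f : ℤ → ℝ) (hf : ∀ t, 0 ≤ f t) (hf0 : ∀ t ≤ 0, f t = 0)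
    (N h : ℤ) (hh : 0 ≤ h) :
    ∑ t ∈ Finset.Icc 1 N, f (t - h) ≤ ∑ t ∈ Finset.Icc 1 N, f t := by
  have himage : ∑ t ∈ (Finset.Icc 1 N).image (fun t => t - h), f t =
      ∑ t ∈ Finset.Icc 1 N, f (t - h) :=
    Finset.sum_image fun a _ b _ hab => by simpa using hab
  have hext : ∑ t ∈ Finset.Icc 1 N, f t = ∑ t ∈ Finset.Icc (1 - h) N, f t := by
    refine Finset.sum_subset (Finset.Icc_subset_Icc_left (by omega)) fun t ht ht' => hf0 t ?_
    simp only [Finset.mem_Icc] at ht ht'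
    omega
  rw [← himage, hext]
  refine Finset.sum_le_sum_of_subset_of_nonneg (fun t ht => ?_) fun t _ _ => hf t
  simp only [Finset.mem_image, Finset.mem_Icc] at ht ⊢
  omega

lemma sum_norm_sq_second_difference_add_le {H : Type*} [NormedAddCommGroup H]
    [InnerProductSpace ℝ H] (x : ℤ → H) (hx : ∀ j : ℤ, j ≤ 0 → x j = x 0)
    (N h : ℤ) (hh : 0 ≤ h) :
    ∑ t ∈ Finset.Icc 1 N, ‖x t - (2 : ℝ) • x (t - h) + x (t - 2 * h)‖ ^ 2 +
        ∑ t ∈ Finset.Icc 1 N, ‖x t - x (t - 2 * h)‖ ^ 2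
      ≤ 4 * ∑ t ∈ Finset.Icc 1 N, ‖x t - x (t - h)‖ ^ 2 := by
  have hshift := sum_Icc_shift_le (fun t => ‖x t - x (t - h)‖ ^ 2) (fun t => by positivity)
    (fun t ht => by simp [hx t ht, hx (t - h) (by omega)]) N h hh
  have hpar : ∀ t : ℤ, ‖x t - (2 : ℝ) • x (t - h) + x (t - 2 * h)‖ ^ 2 +
      ‖x t - x (t - 2 * h)‖ ^ 2 =
      2 * ‖x t - x (t - h)‖ ^ 2 + 2 * ‖x (t - h) - x (t - h - h)‖ ^ 2 := by
    intro t
    have h2 : t - h - h = t - 2 * h := by ring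
    rw [h2]
    have hp := parallelogram_law_with_norm ℝ (x t - x (t - h)) (x (t - h) - x (t - 2 * h))
    have hsub : x t - x (t - h) - (x (t - h) - x (t - 2 * h)) =
        x t - (2 : ℝ) • x (t - h) + x (t - 2 * h) := by module
    rw [sub_add_sub_cancel, hsub] at hp
    linarith
  rw [← Finset.sum_add_distrib, Finset.sum_congr rfl fun t _ => hpar t, Finset.sum_add_distrib,
    ← Finset.mul_sum, ← Finset.mul_sum]
  linarith

lemma sum_dyadic_second_difference_add_le {H : Type*} [NormedAddCommGroup H]
    [InnerProductSpace ℝ H] (x : ℤ → H) (hx : ∀ j : ℤ, j ≤ 0 → x j = x 0) (N : ℤ) (n : ℕ) :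
    ∑ k ∈ Finset.Icc 1 n, ((2 : ℝ) ^ (2 * k))⁻¹ *
        ∑ t ∈ Finset.Icc 1 N, ‖x t - (2 : ℝ) • x (t - 2 ^ (k - 1)) + x (t - 2 ^ k)‖ ^ 2 +
        ((2 : ℝ) ^ (2 * n))⁻¹ * ∑ t ∈ Finset.Icc 1 N, ‖x t - x (t - 2 ^ n)‖ ^ 2
      ≤ ∑ t ∈ Finset.Icc 1 N, ‖x t - x (t - 1)‖ ^ 2 := by
  induction n with
  | zero => simp
  | succ n ih =>
    rw [Finset.sum_Icc_succ_top (by omega), add_tsub_cancel_right]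
    have hstep := sum_norm_sq_second_difference_add_le x hx N (2 ^ n) (by positivity)
    rw [← pow_succ'] at hstep
    have hpow : ((2 : ℝ) ^ (2 * n))⁻¹ = 4 * ((2 : ℝ) ^ (2 * (n + 1)))⁻¹ := by
      rw [mul_add, pow_add]
      field_simp
      norm_num
    have hscaled := mul_le_mul_of_nonneg_left hstep
      (by positivity : 0 ≤ ((2 : ℝ) ^ (2 * (n + 1)))⁻¹)
    rw [hpow] at ih
    linarith

/-- The shift-averaged dyadic inequality in Hilbert space, with the
convention `x_j = x_0` for `j ≤ 0`. -/
theorem hilbert_dyadic_inequality {H : Type*} [NormedAddCommGroup H]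
    [InnerProductSpace ℝ H] [CompleteSpace H] (m : ℕ) (x : ℤ → H)
    (hx : ∀ j : ℤ, j ≤ 0 → x j = x 0) :
    (1 / 2 : ℝ) * ‖x (2 ^ m) - x 0‖ ^ 2 / 2 ^ (2 * m) +
        (1 / 2 : ℝ) * ∑ k ∈ Finset.Icc 1 m, ((2 : ℝ) ^ (2 * k))⁻¹ *
          ∑ t ∈ Finset.Icc (1 : ℤ) (2 ^ m),
            ‖x t - (2 : ℝ) • x (t - 2 ^ (k - 1)) + x (t - 2 ^ k)‖ ^ 2
      ≤ ∑ i ∈ Finset.Icc (1 : ℤ) (2 ^ m), ‖x i - x (i - 1)‖ ^ 2 := by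
  have hdyadic := sum_dyadic_second_difference_add_le x hx (2 ^ m) m
  have hlast : ‖x (2 ^ m) - x 0‖ ^ 2 ≤
      ∑ t ∈ Finset.Icc (1 : ℤ) (2 ^ m), ‖x t - x (t - 2 ^ m)‖ ^ 2 := by
    have hmem : (2 : ℤ) ^ m ∈ Finset.Icc (1 : ℤ) (2 ^ m) :=
      Finset.mem_Icc.2 ⟨one_le_pow₀ (by norm_num), le_rfl⟩
    simpa using Finset.single_le_sum
      (f := fun t : ℤ => ‖x t - x (t - 2 ^ m)‖ ^ 2) (fun t _ => by positivity) hmem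
  have hscaled := mul_le_mul_of_nonneg_left hlast
    (by positivity : 0 ≤ ((2 : ℝ) ^ (2 * m))⁻¹)
  have hnonneg : 0 ≤ ∑ t ∈ Finset.Icc (1 : ℤ) (2 ^ m), ‖x t - x (t - 1)‖ ^ 2 :=
    Finset.sum_nonneg fun t _ => by positivity
  rw [div_eq_mul_inv]
  linarith

end TreePaper
end

section
/- Let (T, d_T) be a finite graph-theoretic metric tree with positive edge weights, and let T_ℝ be the ℝ-tree obtained by replacing every edge e of T by a closed interval of length ℓ(e). Then for every p ∈ [1,∞), c_p(T_ℝ) ≤ 5 · c_p(T). -/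
open scoped ENNReal

namespace TreePaper

/-- `HasEmbedding dX dY D`: there is a bi-Lipschitz embedding of the distance space
`(X, dX)` into `(Y, dY)` with distortion at most `D`. -/
def HasEmbedding {X Y : Type*} (dX : X → X → ℝ) (dY : Y → Y → ℝ) (D : ℝ) : Prop :=
  ∃ f : X → Y, ∃ s : ℝ, 0 < s ∧
    ∀ x x' : X, s * dX x x' ≤ dY (f x) (f x') ∧ dY (f x) (f x') ≤ s * D * dX x x'

/-- `cDist dX dY` is the infimal distortion of bi-Lipschitz embeddings of `X` into `Y`
(`⊤` if no bi-Lipschitz embedding exists); it is at least `1` by convention. -/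
noncomputable def cDist {X Y : Type*} (dX : X → X → ℝ) (dY : Y → Y → ℝ) : ℝ≥0∞ :=
  1 ⊔ sInf {c : ℝ≥0∞ | ∃ r : ℝ, c = ENNReal.ofReal r ∧ HasEmbedding dX dY r}

/-- The Lebesgue space `L_p(ℝ)`. -/
noncomputable def LpSpace (p : ℝ) : Type :=
  MeasureTheory.Lp ℝ (ENNReal.ofReal p) (MeasureTheory.volume : MeasureTheory.Measure ℝ)

noncomputable instance (p : ℝ) : Dist (LpSpace p) :=
  inferInstanceAs (Dist (MeasureTheory.Lp ℝ (ENNReal.ofReal p) MeasureTheory.volume))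

/-- `cLp p dX` is the `L_p`-distortion of the distance space `(X, dX)`. -/
noncomputable def cLp (p : ℝ) {X : Type*} (dX : X → X → ℝ) : ℝ≥0∞ :=
  cDist dX (fun g h : LpSpace p => dist g h)

/-- The points of the `ℝ`-tree `T_ℝ` associated to a metric tree `T`: either vertices of `T`,
or points `(u, v, η)` in the interior of an edge `{u,v}` (at fraction `η ∈ (0,1)` of the way
from `u` to `v`; the two representations `(u,v,η)` and `(v,u,1-η)` are at distance `0`). -/
def TRpt (T : MetricTree) : Type :=
  T.V ⊕ {q : T.V × T.V × ℝ // T.G.Adj q.1 q.2.1 ∧ 0 < q.2.2 ∧ q.2.2 < 1}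

open scoped Classical in
/-- The path (pseudo)metric of the `ℝ`-tree `T_ℝ`. -/
noncomputable def TRdist (T : MetricTree) (x y : TRpt T) : ℝ :=
  match x, y with
  | .inl a, .inl b => T.dist a b
  | .inl a, .inr q =>
      min (T.dist a q.1.1 + q.1.2.2 * T.w s(q.1.1, q.1.2.1))
        (T.dist a q.1.2.1 + (1 - q.1.2.2) * T.w s(q.1.1, q.1.2.1))
  | .inr q, .inl b =>
      min (T.dist q.1.1 b + q.1.2.2 * T.w s(q.1.1, q.1.2.1))
        (T.dist q.1.2.1 b + (1 - q.1.2.2) * T.w s(q.1.1, q.1.2.1))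
  | .inr q, .inr q' =>
      if s(q.1.1, q.1.2.1) = s(q'.1.1, q'.1.2.1) then
        (if q.1.1 = q'.1.1 then |q.1.2.2 - q'.1.2.2| * T.w s(q.1.1, q.1.2.1)
         else |q.1.2.2 + q'.1.2.2 - 1| * T.w s(q.1.1, q.1.2.1))
      else
        min
          (min (q.1.2.2 * T.w s(q.1.1, q.1.2.1) + T.dist q.1.1 q'.1.1
                  + q'.1.2.2 * T.w s(q'.1.1, q'.1.2.1))
               (q.1.2.2 * T.w s(q.1.1, q.1.2.1) + T.dist q.1.1 q'.1.2.1
                  + (1 - q'.1.2.2) * T.w s(q'.1.1, q'.1.2.1)))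
          (min ((1 - q.1.2.2) * T.w s(q.1.1, q.1.2.1) + T.dist q.1.2.1 q'.1.1
                  + q'.1.2.2 * T.w s(q'.1.1, q'.1.2.1))
               ((1 - q.1.2.2) * T.w s(q.1.1, q.1.2.1) + T.dist q.1.2.1 q'.1.2.1
                  + (1 - q'.1.2.2) * T.w s(q'.1.1, q'.1.2.1)))

open MeasureTheory in
theorem lintegral_enorm_rpow_halfline {p : ℝ} (hp : 1 ≤ p) {k : ℝ → ℝ} (a : ℝ) :
    ∫⁻ x, ‖(if 0 < x then k (Real.log x) * x ^ (-p⁻¹) else if -1 < x then a else 0)‖ₑ ^ p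
      = (∫⁻ x, ‖k x‖ₑ ^ p) + ‖a‖ₑ ^ p := by
  have hp0 : 0 < p := by linarith
  rw [← lintegral_add_compl _ (measurableSet_Ioi (a := (0 : ℝ)))]
  congr 1
  · rw [← Real.range_exp, ← Set.image_univ, lintegral_image_eq_lintegral_abs_deriv_mul
      MeasurableSet.univ (fun x _ => (Real.hasDerivAt_exp x).hasDerivWithinAt)
      Real.exp_injective.injOn, setLIntegral_univ]
    refine lintegral_congr fun x => ?_
    rw [if_pos (Real.exp_pos x), Real.log_exp, enorm_mul, ENNReal.mul_rpow_of_nonneg _ _ hp0.le,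
      mul_left_comm, abs_of_pos (Real.exp_pos x),
      Real.enorm_of_nonneg (by positivity : (0:ℝ) ≤ Real.exp x ^ (-p⁻¹)),
      ENNReal.ofReal_rpow_of_nonneg (by positivity) hp0.le, ← Real.rpow_mul (Real.exp_pos x).le,
      neg_mul, inv_mul_cancel₀ hp0.ne', Real.rpow_neg_one, ← ENNReal.ofReal_mul (Real.exp_pos x).le,
      mul_inv_cancel₀ (Real.exp_pos x).ne', ENNReal.ofReal_one, mul_one]
  · rw [Set.compl_Ioi, setLIntegral_congr_fun measurableSet_Iic
      (g := (Set.Ioc (-1 : ℝ) 0).indicator fun _ => ‖a‖ₑ ^ p)]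
    · rw [lintegral_indicator measurableSet_Ioc, Measure.restrict_restrict measurableSet_Ioc,
        Set.inter_eq_left.2 Set.Ioc_subset_Iic_self]
      simp
    · intro x hx
      have hx' : ¬ 0 < x := not_lt.2 hx
      by_cases h : -1 < x <;> simp [hx', h, Set.indicator, hp0, not_lt.1 hx']

open MeasureTheory in
theorem exists_Lp_dist_rpow_add {p : ℝ} (hp : 1 ≤ p) :
    ∃ J : Lp ℝ (ENNReal.ofReal p) (volume : Measure ℝ) → ℝ →
        Lp ℝ (ENNReal.ofReal p) (volume : Measure ℝ),
      ∀ g h a b, dist (J g a) (J h b) ^ p = dist g h ^ p + |a - b| ^ p := by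
  have hp0 : 0 < p := by linarith
  have hP0 : ENNReal.ofReal p ≠ 0 := by simpa using hp0
  have : Fact (1 ≤ ENNReal.ofReal p) := ⟨by simpa using hp⟩
  have key (k : ℝ → ℝ) : eLpNorm k (ENNReal.ofReal p) volume ^ p = ∫⁻ x, ‖k x‖ₑ ^ p := by
    rw [eLpNorm_eq_lintegral_rpow_enorm_toReal hP0 ENNReal.ofReal_ne_top,
      ENNReal.toReal_ofReal hp0.le, one_div, ENNReal.rpow_inv_rpow hp0.ne']
  let K (k : ℝ → ℝ) (a x : ℝ) : ℝ :=
    if 0 < x then k (Real.log x) * x ^ (-p⁻¹) else if -1 < x then a else 0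
  have hK (k : ℝ → ℝ) (a : ℝ) : eLpNorm (K k a) (ENNReal.ofReal p) volume ^ p
      = eLpNorm k (ENNReal.ofReal p) volume ^ p + ‖a‖ₑ ^ p := by
    rw [key, key]
    exact lintegral_enorm_rpow_halfline hp a
  have hKmem (g : Lp ℝ (ENNReal.ofReal p) (volume : Measure ℝ)) (a : ℝ) :
      MemLp (K g a) (ENNReal.ofReal p) volume := by
    refine ⟨?_, ?_⟩
    · have hg := (Lp.stronglyMeasurable g).measurable
      refine Measurable.aestronglyMeasurable ?_
      refine Measurable.ite measurableSet_Ioi (by fun_prop)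
        (Measurable.ite measurableSet_Ioi (by fun_prop) (by fun_prop))
    · have : eLpNorm (K g a) (ENNReal.ofReal p) volume ^ p < ∞ := by
        rw [hK]
        refine ENNReal.add_lt_top.2 ⟨ENNReal.rpow_lt_top_of_nonneg hp0.le (Lp.eLpNorm_ne_top g),
          ENNReal.rpow_lt_top_of_nonneg hp0.le (by simp)⟩
      exact (ENNReal.rpow_lt_top_iff_of_pos hp0).1 this
  refine ⟨fun g a => (hKmem g a).toLp, fun g h a b => ?_⟩
  have hsub : K g a - K h b = K (g - h) (a - b) := by
    ext x
    simp only [K, Pi.sub_apply]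
    split_ifs <;> ring
  have he : edist ((hKmem g a).toLp) ((hKmem h b).toLp) ^ p = edist g h ^ p + edist a b ^ p := by
    rw [Lp.edist_toLp_toLp, hsub, hK, Lp.edist_def, edist_eq_enorm_sub]
  have := congrArg ENNReal.toReal he
  rw [ENNReal.toReal_add (ENNReal.rpow_ne_top_of_nonneg hp0.le (edist_ne_top _ _))
    (ENNReal.rpow_ne_top_of_nonneg hp0.le (edist_ne_top _ _))] at this
  simpa only [← ENNReal.toReal_rpow, ← dist_edist, Real.dist_eq] using this

open MeasureTheory in
theorem exists_Lp_dist_rpow_add_sum {p : ℝ} (hp : 1 ≤ p) (ι : Type*) [Fintype ι] :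
    ∃ J : Lp ℝ (ENNReal.ofReal p) (volume : Measure ℝ) → (ι → ℝ) →
        Lp ℝ (ENNReal.ofReal p) (volume : Measure ℝ),
      ∀ g h a b, dist (J g a) (J h b) ^ p = dist g h ^ p + ∑ i, |a i - b i| ^ p := by
  refine Fintype.induction_empty_option (P := fun ι _ =>
    ∃ J : Lp ℝ (ENNReal.ofReal p) (volume : Measure ℝ) → (ι → ℝ) →
        Lp ℝ (ENNReal.ofReal p) (volume : Measure ℝ),
      ∀ g h a b, dist (J g a) (J h b) ^ p = dist g h ^ p + ∑ i, |a i - b i| ^ p)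
    (fun α β _ e ih => ?_) ?_ (fun α _ ih => ?_) ι
  · obtain ⟨J, hJ⟩ := ih
    refine ⟨fun g a => J g (a ∘ e), fun g h a b => ?_⟩
    let := Fintype.ofEquiv _ e.symm
    rw [hJ, ← e.sum_comp]
    rfl
  · exact ⟨fun g _ => g, by simp⟩
  · obtain ⟨J, hJ⟩ := ih
    obtain ⟨J₁, hJ₁⟩ := exists_Lp_dist_rpow_add hp
    refine ⟨fun g a => J₁ (J g (a ∘ some)) (a none), fun g h a b => ?_⟩
    rw [hJ₁, hJ, Fintype.sum_option]
    simp only [Function.comp_apply]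
    ring

namespace MetricTree

variable (T : MetricTree)

theorem path_isPath_s18 (u v : T.V) : (T.path u v).IsPath :=
  (T.isTree.existsUnique_path u v).exists.choose_spec

theorem dist_nonneg (u v : T.V) : 0 ≤ T.dist u v := by
  refine List.sum_nonneg fun x hx => ?_
  obtain ⟨e, he, rfl⟩ := List.mem_map.1 hx
  exact (T.w_pos e ((T.path u v).edges_subset_edgeSet he)).le

theorem dist_of_adj {u v : T.V} (h : T.G.Adj u v) : T.dist u v = T.w s(u, v) := by
  have := (T.isTree.existsUnique_path u v).unique (T.path_isPath_s18 u v)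
    (SimpleGraph.Walk.IsPath.of_adj h)
  simp [dist, this]

end MetricTree

/-- `IsAnchor x u r`: `u` is an endpoint of the edge containing `x`, at distance `r` from `x`. -/
def IsAnchor {T : MetricTree} (x : TRpt T) (u : T.V) (r : ℝ) : Prop :=
  match x with
  | .inl a => u = a ∧ r = 0
  | .inr q => (u = q.1.1 ∧ r = q.1.2.2 * T.w s(q.1.1, q.1.2.1)) ∨
      (u = q.1.2.1 ∧ r = (1 - q.1.2.2) * T.w s(q.1.1, q.1.2.1))

/-- Both points lie in the interior of the same edge. -/
def SameEdge {T : MetricTree} (x y : TRpt T) : Prop :=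
  match x, y with
  | .inr q, .inr q' => s(q.1.1, q.1.2.1) = s(q'.1.1, q'.1.2.1)
  | _, _ => False

/-- The distance from a point of `T_ℝ` to the nearest vertex. -/
noncomputable def depth {T : MetricTree} (x : TRpt T) : ℝ :=
  match x with
  | .inl _ => 0
  | .inr q => min q.1.2.2 (1 - q.1.2.2) * T.w s(q.1.1, q.1.2.1)

open scoped Classical in
/-- The depth of a point, recorded in the coordinate of the edge containing it. -/
noncomputable def depthVec {T : MetricTree} (x : TRpt T) : Sym2 T.V → ℝ :=
  match x with
  | .inl _ => 0
  | .inr q => Pi.single s(q.1.1, q.1.2.1) (depth (.inr q))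

/-- The piecewise affine extension to `T_ℝ` of a map defined on the vertices. -/
noncomputable def affineExtend {T : MetricTree} {E : Type*} [AddCommGroup E] [Module ℝ E]
    (f : T.V → E) (x : TRpt T) : E :=
  match x with
  | .inl a => f a
  | .inr q => AffineMap.lineMap (f q.1.1) (f q.1.2.1) q.1.2.2

section

variable {T : MetricTree}

theorem TRdist_le_of_isAnchor {x y : TRpt T} (hxy : ¬ SameEdge x y) {u v : T.V} {r t : ℝ}
    (hx : IsAnchor x u r) (hy : IsAnchor y v t) : TRdist T x y ≤ r + T.dist u v + t := by
  rcases x with a | q <;> rcases y with b | q'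
  · obtain ⟨rfl, rfl⟩ := hx
    obtain ⟨rfl, rfl⟩ := hy
    simp [TRdist]
  · obtain ⟨rfl, rfl⟩ := hx
    rcases hy with ⟨rfl, rfl⟩ | ⟨rfl, rfl⟩ <;> simp [TRdist]
  · obtain ⟨rfl, rfl⟩ := hy
    rcases hx with ⟨rfl, rfl⟩ | ⟨rfl, rfl⟩ <;> simp [TRdist, add_comm]
  · simp only [TRdist, if_neg (show ¬ s(q.1.1, q.1.2.1) = s(q'.1.1, q'.1.2.1) from hxy)]
    rcases hx with ⟨rfl, rfl⟩ | ⟨rfl, rfl⟩ <;> rcases hy with ⟨rfl, rfl⟩ | ⟨rfl, rfl⟩ <;>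
      simp only [min_le_iff, le_refl, true_or, or_true]

theorem exists_isAnchor_TRdist_eq {x y : TRpt T} (hxy : ¬ SameEdge x y) :
    ∃ u v r t, IsAnchor x u r ∧ IsAnchor y v t ∧ TRdist T x y = r + T.dist u v + t := by
  rcases x with a | q <;> rcases y with b | q'
  · exact ⟨a, b, 0, 0, ⟨rfl, rfl⟩, ⟨rfl, rfl⟩, by simp [TRdist]⟩
  · simp only [TRdist]
    rcases min_choice (T.dist a q'.1.1 + q'.1.2.2 * T.w s(q'.1.1, q'.1.2.1))
      (T.dist a q'.1.2.1 + (1 - q'.1.2.2) * T.w s(q'.1.1, q'.1.2.1)) with h | h <;> rw [h]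
    · exact ⟨_, _, _, _, ⟨rfl, rfl⟩, .inl ⟨rfl, rfl⟩, by ring⟩
    · exact ⟨_, _, _, _, ⟨rfl, rfl⟩, .inr ⟨rfl, rfl⟩, by ring⟩
  · simp only [TRdist]
    rcases min_choice (T.dist q.1.1 b + q.1.2.2 * T.w s(q.1.1, q.1.2.1))
      (T.dist q.1.2.1 b + (1 - q.1.2.2) * T.w s(q.1.1, q.1.2.1)) with h | h <;> rw [h]
    · exact ⟨_, _, _, _, .inl ⟨rfl, rfl⟩, ⟨rfl, rfl⟩, by ring⟩
    · exact ⟨_, _, _, _, .inr ⟨rfl, rfl⟩, ⟨rfl, rfl⟩, by ring⟩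
  · simp only [TRdist, if_neg (show ¬ s(q.1.1, q.1.2.1) = s(q'.1.1, q'.1.2.1) from hxy)]
    simp only [min_def]
    split_ifs
    all_goals first
      | exact ⟨_, _, _, _, .inl ⟨rfl, rfl⟩, .inl ⟨rfl, rfl⟩, rfl⟩
      | exact ⟨_, _, _, _, .inl ⟨rfl, rfl⟩, .inr ⟨rfl, rfl⟩, rfl⟩
      | exact ⟨_, _, _, _, .inr ⟨rfl, rfl⟩, .inl ⟨rfl, rfl⟩, rfl⟩
      | exact ⟨_, _, _, _, .inr ⟨rfl, rfl⟩, .inr ⟨rfl, rfl⟩, rfl⟩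

theorem depth_nonneg (x : TRpt T) : 0 ≤ depth x := by
  rcases x with a | ⟨q, hadj, h0, h1⟩
  · exact le_rfl
  · exact mul_nonneg (le_min h0.le (by linarith)) (T.w_pos s(q.1, q.2.1) hadj).le

theorem exists_isAnchor_depth (x : TRpt T) : ∃ u, IsAnchor x u (depth x) := by
  rcases x with a | q
  · exact ⟨a, rfl, rfl⟩
  · rcases min_choice q.1.2.2 (1 - q.1.2.2) with h | h
    · exact ⟨q.1.1, .inl ⟨rfl, by simp only [depth, h]⟩⟩
    · exact ⟨q.1.2.1, .inr ⟨rfl, by simp only [depth, h]⟩⟩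

theorem IsAnchor.depth_le {x : TRpt T} {u : T.V} {r : ℝ} (h : IsAnchor x u r) : depth x ≤ r := by
  rcases x with a | ⟨q, hadj, h0, h1⟩
  · exact h.2.ge
  · have hw := (T.w_pos s(q.1, q.2.1) hadj).le
    rcases h with ⟨-, rfl⟩ | ⟨-, rfl⟩
    · exact mul_le_mul_of_nonneg_right (min_le_left _ _) hw
    · exact mul_le_mul_of_nonneg_right (min_le_right _ _) hw

theorem IsAnchor.dist_affineExtend_le {E : Type*} [NormedAddCommGroup E] [NormedSpace ℝ E]
    {f : T.V → E} {D : ℝ} (hf : ∀ u v, T.G.Adj u v → dist (f u) (f v) ≤ D * T.w s(u, v))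
    {x : TRpt T} {u : T.V} {r : ℝ} (h : IsAnchor x u r) :
    dist (affineExtend f x) (f u) ≤ D * r := by
  rcases x with a | ⟨q, hadj, h0, h1⟩
  · obtain ⟨rfl, rfl⟩ := h
    simp [affineExtend]
  · have hq := hf _ _ hadj
    rcases h with ⟨rfl, rfl⟩ | ⟨rfl, rfl⟩
    · simp only [affineExtend, dist_lineMap_left, Real.norm_of_nonneg h0.le]
      nlinarith
    · simp only [affineExtend, dist_lineMap_right, Real.norm_of_nonneg (sub_nonneg.2 h1.le)]
      nlinarith

/-- Two points in the interior of the same edge have representations with the same orientation. -/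
theorem SameEdge.exists_param {x y : TRpt T} (h : SameEdge x y) :
    ∃ u v t t', T.G.Adj u v ∧ TRdist T x y = |t - t'| * T.w s(u, v) ∧
      depth x = min t (1 - t) * T.w s(u, v) ∧ depth y = min t' (1 - t') * T.w s(u, v) ∧
      ∀ {E : Type} [AddCommGroup E] [Module ℝ E] (f : T.V → E),
        affineExtend f x = AffineMap.lineMap (f u) (f v) t ∧
        affineExtend f y = AffineMap.lineMap (f u) (f v) t' := by
  rcases x with a | ⟨⟨u, v, t⟩, hadj, h0, h1⟩
  · exact h.elim
  rcases y with b | ⟨⟨u', v', t'⟩, hadj', h0', h1'⟩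
  · exact h.elim
  have he : s(u, v) = s(u', v') := h
  rcases Sym2.eq_iff.1 he with ⟨rfl, rfl⟩ | ⟨rfl, rfl⟩
  · exact ⟨u, v, t, t', hadj, by simp [TRdist], rfl, rfl, fun f => ⟨rfl, rfl⟩⟩
  · refine ⟨u, v, t, 1 - t', hadj, ?_, rfl, ?_, fun f => ⟨rfl, ?_⟩⟩
    · have hne : u ≠ v := hadj.ne
      simp only [TRdist, if_pos he, if_neg hne]
      congr 2
      ring
    · simp only [depth, sub_sub_cancel, min_comm t', Sym2.eq_swap (a := v)]
    · simp [affineExtend, AffineMap.lineMap_apply_one_sub]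

theorem sum_depthVec [Fintype (Sym2 T.V)] {p D : ℝ} (hp : 1 ≤ p) (hD : 0 ≤ D)
    (x : TRpt T) : ∑ i, |D * depthVec x i| ^ p = (D * depth x) ^ p := by
  classical
  have hp0 : p ≠ 0 := by linarith
  rcases x with a | q
  · simp [depthVec, depth, hp0]
  · rw [Finset.sum_eq_single s(q.1.1, q.1.2.1)]
    · simp only [depthVec, Pi.single_eq_same]
      exact congrArg (· ^ p) (abs_of_nonneg (mul_nonneg hD (depth_nonneg (T := T) (.inr q))))
    · intro i _ hi
      simp [depthVec, Pi.single_eq_of_ne hi, hp0]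
    · simp

theorem depthVec_eq_zero_or {x y : TRpt T} (h : ¬ SameEdge x y) (i : Sym2 T.V) :
    depthVec x i = 0 ∨ depthVec y i = 0 := by
  classical
  rcases x with a | q
  · exact .inl rfl
  rcases y with b | q'
  · exact .inr rfl
  by_cases hi : i = s(q.1.1, q.1.2.1)
  · right
    subst hi
    exact Pi.single_eq_of_ne h _
  · exact .inl (Pi.single_eq_of_ne hi _)

theorem sum_depthVec_sub_of_not_sameEdge [Fintype (Sym2 T.V)] {p D : ℝ} (hp : 1 ≤ p) (hD : 0 ≤ D)
    {x y : TRpt T} (h : ¬ SameEdge x y) :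
    ∑ i, |D * depthVec x i - D * depthVec y i| ^ p = (D * depth x) ^ p + (D * depth y) ^ p := by
  have hp0 : p ≠ 0 := by linarith
  rw [← sum_depthVec hp hD x, ← sum_depthVec hp hD y, ← Finset.sum_add_distrib]
  refine Finset.sum_congr rfl fun i _ => ?_
  rcases depthVec_eq_zero_or h i with h | h <;> simp [h, hp0]

theorem sum_depthVec_sub_of_sameEdge [Fintype (Sym2 T.V)] {p D : ℝ} (hp : 1 ≤ p) (hD : 0 ≤ D)
    {x y : TRpt T} (h : SameEdge x y) :
    ∑ i, |D * depthVec x i - D * depthVec y i| ^ p = (D * |depth x - depth y|) ^ p := by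
  classical
  have hp0 : p ≠ 0 := by linarith
  rcases x with a | q
  · exact h.elim
  rcases y with b | q'
  · exact h.elim
  have he : s(q.1.1, q.1.2.1) = s(q'.1.1, q'.1.2.1) := h
  rw [Finset.sum_eq_single s(q.1.1, q.1.2.1)]
  · simp only [depthVec, ← he, Pi.single_eq_same]
    rw [← mul_sub, abs_mul, abs_of_nonneg hD]
  · intro i _ hi
    simp [depthVec, ← he, Pi.single_eq_of_ne hi, hp0]
  · simp

end

theorem rpow_weighted_sum_le {p a b c : ℝ} (hp : 1 ≤ p) (ha : 0 ≤ a) (hb : 0 ≤ b) (hc : 0 ≤ c) :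
    2 * ((a + 2 * b + 2 * c) / 5) ^ p ≤ a ^ p + b ^ p + c ^ p := by
  have h := Real.rpow_arith_mean_le_arith_mean_rpow Finset.univ ![1 / 5, 2 / 5, 2 / 5] ![a, b, c]
    (by intro i _; fin_cases i <;> norm_num) (by simp [Fin.sum_univ_three]; norm_num)
    (by intro i _; fin_cases i <;> simpa) hp
  simp only [Fin.sum_univ_three, Matrix.cons_val] at h
  rw [show (a + 2 * b + 2 * c) / 5 = 1 / 5 * a + 2 / 5 * b + 2 / 5 * c by ring]
  have := Real.rpow_nonneg ha p
  have := Real.rpow_nonneg hb p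
  have := Real.rpow_nonneg hc p
  linarith

open MeasureTheory in
theorem hasEmbedding_TRdist {T : MetricTree} [Finite T.V] {p : ℝ} (hp : 1 ≤ p) {D : ℝ}
    (hD : 1 ≤ D) (h : HasEmbedding T.dist (fun g h : LpSpace p => dist g h) D) :
    HasEmbedding (TRdist T) (fun g h : LpSpace p => dist g h) (5 * D) := by
  have : Fact (1 ≤ ENNReal.ofReal p) := ⟨by simpa using hp⟩
  have := Fintype.ofFinite (Sym2 T.V)
  have hp0 : 0 < p := by linarith
  have hD0 : 0 ≤ D := by linarith
  obtain ⟨f₀, s, hs, hf₀⟩ := h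
  let E := Lp ℝ (ENNReal.ofReal p) (volume : Measure ℝ)
  let f : T.V → E := fun v => s⁻¹ • (show E from f₀ v)
  have hdist (u v : T.V) : dist (f u) (f v) = s⁻¹ * dist (f₀ u) (f₀ v) := by
    rw [dist_smul₀, Real.norm_of_nonneg (by positivity)]
    rfl
  have hlow (u v : T.V) : T.dist u v ≤ dist (f u) (f v) := by
    rw [hdist, inv_mul_eq_div, le_div_iff₀ hs, mul_comm]
    exact (hf₀ u v).1
  have hup (u v : T.V) : dist (f u) (f v) ≤ D * T.dist u v := by
    rw [hdist, inv_mul_eq_div, div_le_iff₀ hs]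
    calc _ ≤ _ := (hf₀ u v).2
      _ = _ := by ring
  have hedge (u v : T.V) (huv : T.G.Adj u v) : dist (f u) (f v) ≤ D * T.w s(u, v) := by
    rw [← T.dist_of_adj huv]
    exact hup u v
  obtain ⟨J, hJ⟩ := exists_Lp_dist_rpow_add_sum hp (Sym2 T.V)
  have hroot {M d : ℝ} (hM : 0 ≤ M) (hd : 0 ≤ d) (h₁ : 2 * (d / 5) ^ p ≤ M ^ p)
      (h₂ : M ^ p ≤ 2 * (D * d) ^ p) :
      2 ^ p⁻¹ / 5 * d ≤ M ∧ M ≤ 2 ^ p⁻¹ / 5 * (5 * D) * d := by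
    have h2 : ((2 : ℝ) ^ p⁻¹) ^ p = 2 := Real.rpow_inv_rpow (by norm_num) hp0.ne'
    constructor
    · rw [← Real.rpow_le_rpow_iff (by positivity) hM hp0, div_mul_eq_mul_div, mul_div_assoc,
        Real.mul_rpow (by positivity) (by positivity), h2]
      exact h₁
    · rw [← Real.rpow_le_rpow_iff hM (by positivity) hp0,
        show (2 : ℝ) ^ p⁻¹ / 5 * (5 * D) * d = 2 ^ p⁻¹ * (D * d) by ring,
        Real.mul_rpow (by positivity) (by positivity), h2]
      exact h₂
  refine ⟨fun x => J (affineExtend f x) (fun i => D * depthVec x i), 2 ^ p⁻¹ / 5, by positivity,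
    fun x y => ?_⟩
  have hM := hJ (affineExtend f x) (affineExtend f y) (fun i => D * depthVec x i)
    (fun i => D * depthVec y i)
  change 2 ^ p⁻¹ / 5 * TRdist T x y ≤ dist (J (affineExtend f x) (fun i => D * depthVec x i))
      (J (affineExtend f y) (fun i => D * depthVec y i)) ∧
    dist (J (affineExtend f x) (fun i => D * depthVec x i))
      (J (affineExtend f y) (fun i => D * depthVec y i)) ≤ 2 ^ p⁻¹ / 5 * (5 * D) * TRdist T x y
  have hA := dist_nonneg (x := affineExtend f x) (y := affineExtend f y)
  by_cases hxy : SameEdge x y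
  · rw [sum_depthVec_sub_of_sameEdge hp hD0 hxy] at hM
    obtain ⟨u, v, t, t', huv, hd, hx, hy, hext⟩ := hxy.exists_param
    have hw : 0 < T.w s(u, v) := T.w_pos _ huv
    have hA' : dist (affineExtend f x) (affineExtend f y) = |t - t'| * dist (f u) (f v) := by
      rw [(hext f).1, (hext f).2, dist_lineMap_lineMap, Real.dist_eq]
    have hd0 : 0 ≤ TRdist T x y := by rw [hd]; positivity
    have hdA : TRdist T x y ≤ dist (affineExtend f x) (affineExtend f y) := by
      rw [hd, hA', ← T.dist_of_adj huv]
      exact mul_le_mul_of_nonneg_left (hlow u v) (abs_nonneg _)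
    have hAd : dist (affineExtend f x) (affineExtend f y) ≤ D * TRdist T x y := by
      rw [hd, hA', mul_left_comm]
      exact mul_le_mul_of_nonneg_left (hedge u v huv) (abs_nonneg _)
    have hmin : |min t (1 - t) - min t' (1 - t')| ≤ |t - t'| := by
      refine (abs_min_sub_min_le_max _ _ _ _).trans (max_le le_rfl ?_)
      rw [sub_sub_sub_cancel_left, abs_sub_comm]
    have hBd : D * |depth x - depth y| ≤ D * TRdist T x y := by
      rw [hd, hx, hy, ← sub_mul, abs_mul, abs_of_pos hw]
      gcongr
    refine hroot dist_nonneg hd0 ?_ ?_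
    · rw [hM]
      have h₁ := rpow_weighted_sum_le hp hd0 le_rfl le_rfl
      have h₂ := Real.rpow_le_rpow hd0 hdA hp0.le
      have h₃ : 0 ≤ (D * |depth x - depth y|) ^ p := by positivity
      rw [Real.zero_rpow hp0.ne'] at h₁
      simp only [mul_zero, add_zero] at h₁
      linarith
    · rw [hM, two_mul]
      gcongr
  · rw [sum_depthVec_sub_of_not_sameEdge hp hD0 hxy] at hM
    have hx0 := depth_nonneg x
    have hy0 := depth_nonneg y
    obtain ⟨u, v, r, t, hxu, hyv, hd⟩ := exists_isAnchor_TRdist_eq hxy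
    obtain ⟨u', hu'⟩ := exists_isAnchor_depth x
    obtain ⟨v', hv'⟩ := exists_isAnchor_depth y
    have hr := hxu.depth_le
    have ht := hyv.depth_le
    have huv := T.dist_nonneg u v
    have hd0 : 0 ≤ TRdist T x y := by rw [hd]; linarith
    have hAd : dist (affineExtend f x) (affineExtend f y) ≤ D * TRdist T x y := by
      have h₁ := dist_triangle4 (affineExtend f x) (f u) (f v) (affineExtend f y)
      have h₂ := hxu.dist_affineExtend_le hedge
      have h₃ := hyv.dist_affineExtend_le hedge
      rw [dist_comm] at h₃
      rw [hd]
      linarith [hup u v]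
    have hBd : D * depth x + D * depth y ≤ D * TRdist T x y := by
      rw [← mul_add]
      exact mul_le_mul_of_nonneg_left (by linarith) hD0
    have hdA : TRdist T x y ≤ dist (affineExtend f x) (affineExtend f y) +
        2 * (D * depth x) + 2 * (D * depth y) := by
      have h₁ := dist_triangle4 (f u') (affineExtend f x) (affineExtend f y) (f v')
      have h₂ := hu'.dist_affineExtend_le hedge
      have h₃ := hv'.dist_affineExtend_le hedge
      rw [dist_comm] at h₂
      have h₄ := TRdist_le_of_isAnchor hxy hu' hv'
      have h₅ := le_mul_of_one_le_left hx0 hD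
      have h₆ := le_mul_of_one_le_left hy0 hD
      linarith [hlow u' v']
    refine hroot dist_nonneg hd0 ?_ ?_
    · rw [hM, ← add_assoc]
      refine le_trans ?_ (rpow_weighted_sum_le hp hA (mul_nonneg hD0 hx0) (mul_nonneg hD0 hy0))
      gcongr
    · have h₁ := Real.rpow_le_rpow hA hAd hp0.le
      have h₂ := Real.add_rpow_le_rpow_add (mul_nonneg hD0 hx0) (mul_nonneg hD0 hy0) hp
      have h₃ := Real.rpow_le_rpow (by positivity) hBd hp0.le
      linarith

theorem HasEmbedding.mono {X Y : Type*} {dX : X → X → ℝ} {dY : Y → Y → ℝ} {D D' : ℝ}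
    (hX : ∀ x x', 0 ≤ dX x x') (hD : D ≤ D') (h : HasEmbedding dX dY D) :
    HasEmbedding dX dY D' := by
  obtain ⟨f, s, hs, hf⟩ := h
  refine ⟨f, s, hs, fun x x' => ⟨(hf x x').1, (hf x x').2.trans ?_⟩⟩
  have := hX x x'
  gcongr

/-- For every finite metric tree `T` and `p ∈ [1,∞)`,
`c_p(T_ℝ) ≤ 5 c_p(T)`. -/
theorem rtree_distortion_bound (T : MetricTree) (hfin : Finite T.V)
    (p : ℝ) (hp : 1 ≤ p) :
    cLp p (TRdist T) ≤ 5 * cLp p T.dist := by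
  have h5 : (5 : ℝ≥0∞) ≠ 0 := by norm_num
  rw [mul_comm, ← ENNReal.div_le_iff h5 (by norm_num)]
  refine le_of_forall_gt_imp_ge_of_dense fun b hb => ?_
  obtain ⟨hb1, hbS⟩ := sup_lt_iff.1 hb
  obtain ⟨_, ⟨r, rfl, hr⟩, hrb⟩ := sInf_lt_iff.1 hbS
  rw [ENNReal.div_le_iff h5 (by norm_num)]
  refine sup_le ?_ ?_
  · calc (1 : ℝ≥0∞) = 1 * 1 := (mul_one 1).symm
      _ ≤ b * 5 := mul_le_mul' hb1.le (by norm_num)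
  · have h := hasEmbedding_TRdist hp (le_max_right r 1)
      (hr.mono T.dist_nonneg (le_max_left r 1))
    refine le_trans (sInf_le ?_) (?_ : ENNReal.ofReal (5 * max r 1) ≤ b * 5)
    · exact ⟨_, rfl, h⟩
    rw [ENNReal.ofReal_mul (by norm_num), mul_comm, ENNReal.ofReal_ofNat]
    gcongr
    rw [ENNReal.ofReal_max, ENNReal.ofReal_one]
    exact max_le hrb.le hb1.le

end TreePaper
end
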